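/- arXiv:math/0702154 — 2 statements merged into one kernel-verified Lean document; each statement's English description precedes it below -/
import Mathlib

section
/- Let N ≥ 0 and d ≥ 1 be integers and λ₀,…,λ_N ∈ ℤ. For a nonzero vector v = (v₀,…,v_N) ∈ ℂ^{N+1}, define its Mumford weight λ(v) = min{λᵢ : vᵢ ≠ 0}. Let v₁,…,v_d ∈ ℂ^{N+1} be nonzero vectors and let P = Π_{j=1}^d (Σ_{i=0}^N v_{j,i}·Xᵢ) be the product of the corresponding linear forms in ℂ[X₀,…,X_N]. Then P ≠ 0 and the minimal weighted degree of P, where the variable Xᵢ is given weight λᵢ, equals Σ_{j=1}^d λ(v_j). -/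
open MvPolynomial

/-- The minimal weighted degree of a multivariate polynomial: the minimum, over all
monomials in its support, of the sum of the weights of the variables (with multiplicity). -/
noncomputable def minWeightedDegree {σ : Type*} (w : σ → ℤ) (p : MvPolynomial σ ℂ) :
    WithTop ℤ :=
  p.support.inf fun m => ((m.sum fun i e => w i * (e : ℤ) : ℤ) : WithTop ℤ)

open Classical in
/-- The Mumford weight of a nonzero vector: the minimum of the weights `lam i` over the
indices `i` where the coordinate `v i` is nonzero (junk value `0` for the zero vector). -/
noncomputable def mumfordWeight {ι : Type*} [Fintype ι] (lam : ι → ℤ) (v : ι → ℂ) : ℤ :=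
  if h : (Finset.univ.filter fun i => v i ≠ 0).Nonempty then
    (Finset.univ.filter fun i => v i ≠ 0).inf' h lam
  else 0

lemma le_weight_of_mem_support_mul {σ : Type*} {w : σ → ℤ} {p q : MvPolynomial σ ℂ} {a b : ℤ}
    (hp : ∀ m ∈ p.support, a ≤ Finsupp.weight w m)
    (hq : ∀ m ∈ q.support, b ≤ Finsupp.weight w m) :
    ∀ m ∈ (p * q).support, a + b ≤ Finsupp.weight w m := by
  classical
  intro m hm
  obtain ⟨x, hx, y, hy, rfl⟩ := Finset.mem_add.1 (support_mul p q hm)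
  rw [map_add]
  exact add_le_add (hp x hx) (hq y hy)

lemma weightedHomogeneousComponent_eq_zero_of_lt {σ : Type*} {w : σ → ℤ} {p : MvPolynomial σ ℂ}
    {a b : ℤ} (hab : a < b) (hp : ∀ m ∈ p.support, b ≤ Finsupp.weight w m) :
    weightedHomogeneousComponent w a p = 0 := by
  refine weightedHomogeneousComponent_eq_zero' a p fun m hm h => ?_
  have := hp m hm
  omega

lemma succ_le_weight_of_mem_support_sub {σ : Type*} {w : σ → ℤ} {p : MvPolynomial σ ℂ} {a : ℤ}
    (hp : ∀ m ∈ p.support, a ≤ Finsupp.weight w m) :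
    ∀ m ∈ (p - weightedHomogeneousComponent w a p).support, a + 1 ≤ Finsupp.weight w m := by
  classical
  intro m hm
  rw [mem_support_iff, coeff_sub, coeff_weightedHomogeneousComponent] at hm
  split_ifs at hm with h
  · simp at hm
  · have := hp m (mem_support_iff.2 (by simpa using hm))
    omega

lemma le_weight_of_mem_support_weightedHomogeneousComponent {σ : Type*} {w : σ → ℤ}
    {p : MvPolynomial σ ℂ} {a : ℤ} :
    ∀ m ∈ (weightedHomogeneousComponent w a p).support, a ≤ Finsupp.weight w m := by
  intro m hm
  exact (weightedHomogeneousComponent_isWeightedHomogeneous a p (mem_support_iff.1 hm)).ge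

lemma weightedHomogeneousComponent_add_mul {σ : Type*} {w : σ → ℤ} {p q : MvPolynomial σ ℂ}
    {a b : ℤ} (hp : ∀ m ∈ p.support, a ≤ Finsupp.weight w m)
    (hq : ∀ m ∈ q.support, b ≤ Finsupp.weight w m) :
    weightedHomogeneousComponent w (a + b) (p * q) =
      weightedHomogeneousComponent w a p * weightedHomogeneousComponent w b q := by
  set pa := weightedHomogeneousComponent w a p with hpa
  set qb := weightedHomogeneousComponent w b q with hqb
  have hsplit : p * q = pa * qb + pa * (q - qb) + (p - pa) * q := by ring
  have h₁ : weightedHomogeneousComponent w (a + b) (pa * (q - qb)) = 0 :=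
    weightedHomogeneousComponent_eq_zero_of_lt (b := a + (b + 1)) (by omega)
      (le_weight_of_mem_support_mul le_weight_of_mem_support_weightedHomogeneousComponent
        (succ_le_weight_of_mem_support_sub hq))
  have h₂ : weightedHomogeneousComponent w (a + b) ((p - pa) * q) = 0 :=
    weightedHomogeneousComponent_eq_zero_of_lt (b := a + 1 + b) (by omega)
      (le_weight_of_mem_support_mul (succ_le_weight_of_mem_support_sub hp) hq)
  have h₃ : weightedHomogeneousComponent w (a + b) (pa * qb) = pa * qb :=
    ((weightedHomogeneousComponent_isWeightedHomogeneous a p).mul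
      (weightedHomogeneousComponent_isWeightedHomogeneous b q)).weightedHomogeneousComponent_same
  rw [hsplit, map_add, map_add, h₁, h₂, h₃, add_zero, add_zero]

/-- `a` is the least weight of a monomial of `p`. -/
def IsMinWeight {σ : Type*} (w : σ → ℤ) (p : MvPolynomial σ ℂ) (a : ℤ) : Prop :=
  (∀ m ∈ p.support, a ≤ Finsupp.weight w m) ∧ weightedHomogeneousComponent w a p ≠ 0

namespace IsMinWeight

variable {σ : Type*} {w : σ → ℤ} {p q : MvPolynomial σ ℂ} {a b : ℤ}

lemma ne_zero (h : IsMinWeight w p a) : p ≠ 0 := by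
  rintro rfl
  exact h.2 (map_zero _)

lemma mul (hp : IsMinWeight w p a) (hq : IsMinWeight w q b) : IsMinWeight w (p * q) (a + b) :=
  ⟨le_weight_of_mem_support_mul hp.1 hq.1, by
    rw [weightedHomogeneousComponent_add_mul hp.1 hq.1]
    exact mul_ne_zero hp.2 hq.2⟩

lemma one : IsMinWeight w 1 0 := by
  refine ⟨fun m hm => ?_, ?_⟩
  · exact (isWeightedHomogeneous_one ℂ w (mem_support_iff.1 hm)).ge
  · rw [(isWeightedHomogeneous_one ℂ w).weightedHomogeneousComponent_same]
    exact one_ne_zero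

lemma prod {ι : Type*} (s : Finset ι) {f : ι → MvPolynomial σ ℂ} {c : ι → ℤ}
    (h : ∀ j ∈ s, IsMinWeight w (f j) (c j)) :
    IsMinWeight w (∏ j ∈ s, f j) (∑ j ∈ s, c j) := by
  classical
  induction s using Finset.induction_on with
  | empty => simpa using one
  | insert j s hj ih =>
    rw [Finset.prod_insert hj, Finset.sum_insert hj]
    exact (h j (Finset.mem_insert_self j s)).mul
      (ih fun k hk => h k (Finset.mem_insert_of_mem hk))

lemma minWeightedDegree_eq (h : IsMinWeight w p a) : minWeightedDegree w p = (a : WithTop ℤ) := by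
  classical
  have hw : ∀ m : σ →₀ ℕ, (m.sum fun i e => w i * (e : ℤ)) = Finsupp.weight w m := fun m => by
    simp [Finsupp.weight_apply, mul_comm]
  simp only [minWeightedDegree, hw]
  refine le_antisymm ?_ (Finset.le_inf fun m hm => WithTop.coe_le_coe.2 (h.1 m hm))
  obtain ⟨m, hm⟩ := ne_zero_iff.1 h.2
  rw [coeff_weightedHomogeneousComponent] at hm
  split_ifs at hm with hma
  · exact (Finset.inf_le (mem_support_iff.2 hm)).trans (WithTop.coe_le_coe.2 hma.le)
  · exact absurd rfl hm

end IsMinWeight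

lemma coeff_single_sum_C_mul_X {ι : Type*} [Fintype ι] (v : ι → ℂ) (i : ι) :
    coeff (Finsupp.single i 1) (∑ k, C (v k) * X k : MvPolynomial ι ℂ) = v i := by
  classical
  simp [coeff_sum, coeff_C_mul, coeff_X, Finsupp.single_left_inj]

lemma exists_single_of_mem_support_sum_C_mul_X {ι : Type*} [Fintype ι] {v : ι → ℂ} {m : ι →₀ ℕ}
    (hm : m ∈ (∑ k, C (v k) * X k : MvPolynomial ι ℂ).support) :
    ∃ i, v i ≠ 0 ∧ m = Finsupp.single i 1 := by
  classical
  rw [mem_support_iff, coeff_sum] at hm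
  obtain ⟨i, -, hi⟩ := Finset.exists_ne_zero_of_sum_ne_zero hm
  rw [coeff_C_mul, coeff_X] at hi
  refine ⟨i, left_ne_zero_of_mul hi, ?_⟩
  by_contra h
  exact hi (by rw [if_neg (Ne.symm h), mul_zero])

lemma isMinWeight_sum_C_mul_X {ι : Type*} [Fintype ι] (lam : ι → ℤ) {v : ι → ℂ} (hv : v ≠ 0) :
    IsMinWeight lam (∑ i, C (v i) * X i : MvPolynomial ι ℂ) (mumfordWeight lam v) := by
  classical
  obtain ⟨i₀, hi₀⟩ := Function.ne_iff.1 hv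
  have hne : (Finset.univ.filter fun i => v i ≠ 0).Nonempty := ⟨i₀, by simpa using hi₀⟩
  have hmw : mumfordWeight lam v = (Finset.univ.filter fun i => v i ≠ 0).inf' hne lam := by
    rw [mumfordWeight, dif_pos (by convert hne)]
  rw [hmw]
  refine ⟨fun m hm => ?_, ?_⟩
  · obtain ⟨i, hi, rfl⟩ := exists_single_of_mem_support_sum_C_mul_X hm
    simpa [Finsupp.weight_single] using Finset.inf'_le lam
      (show i ∈ Finset.univ.filter fun i => v i ≠ 0 by simpa using hi)
  · obtain ⟨i, hi, hmin⟩ := Finset.exists_mem_eq_inf' hne lam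
    rw [hmin]
    refine ne_zero_iff.2 ⟨Finsupp.single i 1, ?_⟩
    rw [coeff_weightedHomogeneousComponent, if_pos (by simp [Finsupp.weight_single]),
      coeff_single_sum_C_mul_X]
    simpa using hi

/-- The product `P` of the linear forms corresponding to nonzero vectors `v₁,…,v_d` is a
nonzero polynomial whose minimal weighted degree (the variable `Xᵢ` having weight `λᵢ`)
equals the sum of the Mumford weights `Σⱼ λ(vⱼ)`. -/
theorem minWeightedDegree_prod_linear_forms (N d : ℕ) (hd : 1 ≤ d)
    (lam : Fin (N + 1) → ℤ) (v : Fin d → Fin (N + 1) → ℂ) (hv : ∀ j, v j ≠ 0) :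
    (∏ j, ∑ i, C (v j i) * X i : MvPolynomial (Fin (N + 1)) ℂ) ≠ 0 ∧
      minWeightedDegree lam (∏ j, ∑ i, C (v j i) * X i : MvPolynomial (Fin (N + 1)) ℂ)
        = ((∑ j, mumfordWeight lam (v j) : ℤ) : WithTop ℤ) := by
  have h := IsMinWeight.prod Finset.univ fun j _ => isMinWeight_sum_C_mul_X lam (hv j)
  exact ⟨h.ne_zero, h.minWeightedDegree_eq⟩
end

section
/- Consider the ℂ[x,y,t]-algebra homomorphism φ : ℂ[x,y,t][ξ₀,ξ₁,ξ₂] → ℂ[x,y,t,s] determined by φ(ξ₀) = x(x−t)·s, φ(ξ₁) = xy·s, φ(ξ₂) = y(y−t)·s (and fixing x, y, t). Then the kernel of φ is the ideal of ℂ[x,y,t][ξ₀,ξ₁,ξ₂] generated by the two elements (x−t)ξ₁ − yξ₀ and (y−t)ξ₁ − xξ₂. -/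
/-- The base ring `ℂ[x,y,t]`, with `x, y, t` the three variables. -/
abbrev Rxyt : Type := MvPolynomial (Fin 3) ℂ

noncomputable def xv : Rxyt := MvPolynomial.X 0
noncomputable def yv : Rxyt := MvPolynomial.X 1
noncomputable def tv : Rxyt := MvPolynomial.X 2

/-- The `ℂ[x,y,t]`-algebra homomorphism `ℂ[x,y,t][ξ₀,ξ₁,ξ₂] → ℂ[x,y,t][s]` sending
`ξ₀ ↦ x(x−t)s`, `ξ₁ ↦ xys`, `ξ₂ ↦ y(y−t)s`. -/
noncomputable def reesMap : MvPolynomial (Fin 3) Rxyt →ₐ[Rxyt] Polynomial Rxyt :=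
  MvPolynomial.aeval
    ![Polynomial.C (xv * (xv - tv)) * Polynomial.X,
      Polynomial.C (xv * yv) * Polynomial.X,
      Polynomial.C (yv * (yv - tv)) * Polynomial.X]

open MvPolynomial in
/-- Two ring homomorphisms out of `ℂ[x,y,t][ξ₀,ξ₁,ξ₂]` agree if they agree on constants and on
the six variables. -/
theorem ringHom_ext_rxyt {A : Type*} [CommRing A] {φ ψ : MvPolynomial (Fin 3) Rxyt →+* A}
    (hc : ∀ a : ℂ, φ (C (C a)) = ψ (C (C a)))
    (hx : φ (C xv) = ψ (C xv)) (hy : φ (C yv) = ψ (C yv)) (ht : φ (C tv) = ψ (C tv))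
    (hX : ∀ i, φ (X i) = ψ (X i)) : φ = ψ := by
  refine MvPolynomial.ringHom_ext' (MvPolynomial.ringHom_ext hc fun i => ?_) hX
  fin_cases i
  · exact hx
  · exact hy
  · exact ht

open MvPolynomial in
/-- The `ℂ`-algebra endomorphism of `ℂ[x,y,t][ξ₀,ξ₁,ξ₂]` substituting `p` for `(x,y,t)` and `q`
for `(ξ₀,ξ₁,ξ₂)`. -/
noncomputable def substHom (p : Fin 3 → Rxyt) (q : Fin 3 → MvPolynomial (Fin 3) Rxyt) :
    MvPolynomial (Fin 3) Rxyt →+* MvPolynomial (Fin 3) Rxyt :=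
  eval₂Hom (C.comp (aeval p : Rxyt →ₐ[ℂ] Rxyt).toRingHom) q

section substHom

open MvPolynomial

variable (p : Fin 3 → Rxyt) (q : Fin 3 → MvPolynomial (Fin 3) Rxyt)

@[simp] theorem substHom_C_C (a : ℂ) : substHom p q (C (C a)) = C (C a) := by
  simp [substHom, algebraMap_eq]

@[simp] theorem substHom_C_xv : substHom p q (C xv) = C (p 0) := by simp [substHom, xv]

@[simp] theorem substHom_C_yv : substHom p q (C yv) = C (p 1) := by simp [substHom, yv]

@[simp] theorem substHom_C_tv : substHom p q (C tv) = C (p 2) := by simp [substHom, tv]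

@[simp] theorem substHom_X (i : Fin 3) : substHom p q (X i) = q i := by simp [substHom]

/-- A substitution that fixes the variables modulo `v` fixes everything modulo `v`. -/
theorem dvd_sub_substHom {v : MvPolynomial (Fin 3) Rxyt}
    (hx : v ∣ C xv - C (p 0)) (hy : v ∣ C yv - C (p 1)) (ht : v ∣ C tv - C (p 2))
    (hX : ∀ i, v ∣ X i - q i) (F : MvPolynomial (Fin 3) Rxyt) : v ∣ F - substHom p q F := by
  have h : Ideal.Quotient.mk (Ideal.span {v}) =
      (Ideal.Quotient.mk (Ideal.span {v})).comp (substHom p q) := by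
    refine ringHom_ext_rxyt (A := MvPolynomial (Fin 3) Rxyt ⧸ Ideal.span {v})
      (fun a => ?_) ?_ ?_ ?_ fun i => ?_ <;>
      simp only [RingHom.comp_apply, substHom_C_C, substHom_C_xv, substHom_C_yv, substHom_C_tv,
        substHom_X, Ideal.Quotient.eq, Ideal.mem_span_singleton]
    exacts [hx, hy, ht, hX i]
  rw [← Ideal.mem_span_singleton, ← Ideal.Quotient.eq]
  exact RingHom.congr_fun h F

end substHom

/-- If a ring endomorphism `σ` is the identity modulo `v`, kills `v` and does not kill `E`, then
`v` divides any `A` with `v ∣ A * E`. -/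
theorem dvd_of_dvd_mul_of_sub_map {P : Type*} [CommRing P] [IsDomain P] {v A E : P} (σ : P →+* P)
    (hσ : ∀ F, v ∣ F - σ F) (hv : σ v = 0) (hE : σ E ≠ 0) (h : v ∣ A * E) : v ∣ A := by
  have h0 : σ A * σ E = 0 := by
    obtain ⟨B, hB⟩ := h
    rw [← map_mul, hB, map_mul, hv, zero_mul]
  simpa [(mul_eq_zero.mp h0).resolve_right hE] using hσ A

/-- `x` is a nonzerodivisor modulo `((x - t)ξ₁ - yξ₀, (y - t)ξ₁ - xξ₂)`, given the
substitutions `x ↦ 0`, `ξ₁ ↦ 0` and `y ↦ t`. -/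
theorem mem_span_pair_of_mul_mem {P : Type*} [CommRing P] [IsDomain P] {x y t ξ₀ ξ₁ ξ₂ : P}
    (σ σ₁ σ₂ : P →+* P)
    (hσ : ∀ F, x ∣ F - σ F) (hx : σ x = 0) (hy : σ y = y) (ht : σ t = t)
    (h₀ : σ ξ₀ = ξ₀) (h₁ : σ ξ₁ = ξ₁)
    (hσ₁ : ∀ F, ξ₁ ∣ F - σ₁ F) (hσ₁ξ : σ₁ ξ₁ = 0) (hne₁ : σ₁ (t * ξ₁ + y * ξ₀) ≠ 0)
    (hσ₂ : ∀ F, y - t ∣ F - σ₂ F) (hσ₂y : σ₂ (y - t) = 0) (hne₂ : σ₂ (t * ξ₁ + y * ξ₀) ≠ 0)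
    (hx0 : x ≠ 0) (hξ₁ : ξ₁ ≠ 0) (hyt : y - t ≠ 0) {F : P}
    (hF : x * F ∈ Ideal.span {(x - t) * ξ₁ - y * ξ₀, (y - t) * ξ₁ - x * ξ₂}) :
    F ∈ Ideal.span {(x - t) * ξ₁ - y * ξ₀, (y - t) * ξ₁ - x * ξ₂} := by
  obtain ⟨a, b, hab⟩ := Ideal.mem_span_pair.mp hF
  have key : σ a * (t * ξ₁ + y * ξ₀) = (y - t) * ξ₁ * σ b := by
    have := congrArg σ hab
    simp only [map_add, map_mul, map_sub, hx, hy, ht, h₀, h₁] at this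
    linear_combination -this
  obtain ⟨A, hA⟩ := dvd_of_dvd_mul_of_sub_map σ₁ hσ₁ hσ₁ξ hne₁
    (Dvd.intro_left ((y - t) * σ b) (by rw [key]; ring) : ξ₁ ∣ σ a * (t * ξ₁ + y * ξ₀))
  have key₂ : A * (t * ξ₁ + y * ξ₀) = (y - t) * σ b := by
    apply mul_left_cancel₀ hξ₁
    rw [hA] at key
    linear_combination key
  obtain ⟨c, rfl⟩ := dvd_of_dvd_mul_of_sub_map σ₂ hσ₂ hσ₂y hne₂ (Dvd.intro _ key₂.symm)
  have hb : σ b = c * (t * ξ₁ + y * ξ₀) := by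
    apply mul_left_cancel₀ hyt
    linear_combination -key₂
  obtain ⟨a', ha'⟩ := hσ a
  obtain ⟨b', hb'⟩ := hσ b
  refine Ideal.mem_span_pair.mpr ⟨a' + c * ξ₂, b' + c * ξ₁, mul_left_cancel₀ hx0 ?_⟩
  rw [← hab, sub_eq_iff_eq_add.mp ha', sub_eq_iff_eq_add.mp hb', hA, hb]
  ring

open MvPolynomial in
theorem ne_zero_of_eval_eval_ne_zero {F : MvPolynomial (Fin 3) Rxyt}
    (h : eval (fun i => if i = 2 then 1 else 2) (eval 1 F) ≠ 0) : F ≠ 0 := by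
  rintro rfl
  simp at h

open MvPolynomial in
theorem rees_mem_of_C_xv_mul_mem {F : MvPolynomial (Fin 3) Rxyt}
    (hF : C xv * F ∈ Ideal.span {C (xv - tv) * X 1 - C yv * X 0, C (yv - tv) * X 1 - C xv * X 2}) :
    F ∈ Ideal.span {C (xv - tv) * X 1 - C yv * X 0, C (yv - tv) * X 1 - C xv * X 2} := by
  simp only [C_sub] at hF ⊢
  refine mem_span_pair_of_mul_mem (substHom ![0, yv, tv] X)
    (substHom ![xv, yv, tv] ![X 0, 0, X 2]) (substHom ![xv, tv, tv] X)
    (dvd_sub_substHom _ _ ?_ ?_ ?_ ?_) ?_ ?_ ?_ ?_ ?_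
    (dvd_sub_substHom _ _ ?_ ?_ ?_ ?_) ?_ (ne_zero_of_eval_eval_ne_zero ?_)
    (dvd_sub_substHom _ _ ?_ ?_ ?_ ?_) ?_ (ne_zero_of_eval_eval_ne_zero ?_)
    (ne_zero_of_eval_eval_ne_zero ?_) (ne_zero_of_eval_eval_ne_zero ?_)
    (ne_zero_of_eval_eval_ne_zero ?_) hF
  all_goals first
    | (simp [Fin.forall_fin_succ]; done)
    | (simp [xv, yv, tv]; done)
    | (simp; norm_num [xv, yv, tv, Fin.ext_iff])

open MvPolynomial in
theorem rees_mem_of_C_yv_mul_mem {F : MvPolynomial (Fin 3) Rxyt}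
    (hF : C yv * F ∈ Ideal.span {C (xv - tv) * X 1 - C yv * X 0, C (yv - tv) * X 1 - C xv * X 2}) :
    F ∈ Ideal.span {C (xv - tv) * X 1 - C yv * X 0, C (yv - tv) * X 1 - C xv * X 2} := by
  rw [Set.pair_comm] at hF ⊢
  simp only [C_sub] at hF ⊢
  refine mem_span_pair_of_mul_mem (substHom ![xv, 0, tv] X)
    (substHom ![xv, yv, tv] ![X 0, 0, X 2]) (substHom ![tv, yv, tv] X)
    (dvd_sub_substHom _ _ ?_ ?_ ?_ ?_) ?_ ?_ ?_ ?_ ?_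
    (dvd_sub_substHom _ _ ?_ ?_ ?_ ?_) ?_ (ne_zero_of_eval_eval_ne_zero ?_)
    (dvd_sub_substHom _ _ ?_ ?_ ?_ ?_) ?_ (ne_zero_of_eval_eval_ne_zero ?_)
    (ne_zero_of_eval_eval_ne_zero ?_) (ne_zero_of_eval_eval_ne_zero ?_)
    (ne_zero_of_eval_eval_ne_zero ?_) hF
  all_goals first
    | (simp [Fin.forall_fin_succ]; done)
    | (simp [xv, yv, tv]; done)
    | (simp; norm_num [xv, yv, tv, Fin.ext_iff])

open MvPolynomial in
/-- Modulo the two relations, every element becomes a polynomial in `ξ₁` after multiplication by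
a power of `xy`. -/
theorem exists_pow_mul_sub_aeval_mem (F : MvPolynomial (Fin 3) Rxyt) :
    ∃ (N : ℕ) (q : Polynomial Rxyt), C (xv * yv) ^ N * F - Polynomial.aeval (X 1) q ∈
      Ideal.span {C (xv - tv) * X 1 - C yv * X 0, C (yv - tv) * X 1 - C xv * X 2} := by
  induction F using MvPolynomial.induction_on with
  | C a => exact ⟨0, Polynomial.C a, by simp [algebraMap_eq]⟩
  | add F G hF hG =>
    obtain ⟨N, q, hq⟩ := hF
    obtain ⟨M, r, hr⟩ := hG
    refine ⟨N + M, Polynomial.C ((xv * yv) ^ M) * q + Polynomial.C ((xv * yv) ^ N) * r, ?_⟩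
    convert add_mem (Ideal.mul_mem_left _ (C (xv * yv) ^ M) hq)
      (Ideal.mul_mem_left _ (C (xv * yv) ^ N) hr) using 1
    simp only [map_add, map_mul, Polynomial.aeval_C, algebraMap_eq, map_pow]
    ring
  | mul_X F i hF =>
    obtain ⟨N, q, hq⟩ := hF
    obtain ⟨c, hc⟩ : ∃ c : Rxyt, C (xv * yv) * X i - C c * X 1 ∈
        Ideal.span {C (xv - tv) * X 1 - C yv * X 0, C (yv - tv) * X 1 - C xv * X 2} := by
      simp only [Ideal.mem_span_pair]
      fin_cases i
      · exact ⟨xv * (xv - tv), -C xv, 0, by simp only [C_mul, Fin.zero_eta]; ring⟩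
      · exact ⟨xv * yv, 0, 0, by simp⟩
      · exact ⟨yv * (yv - tv), 0, -C yv, by simp only [C_mul, Fin.reduceFinMk]; ring⟩
    refine ⟨N + 1, Polynomial.C c * Polynomial.X * q, ?_⟩
    convert add_mem (Ideal.mul_mem_left _ (C (xv * yv) * X i) hq)
      (Ideal.mul_mem_left _ (Polynomial.aeval (X 1) q) hc) using 1
    simp only [map_mul, Polynomial.aeval_C, Polynomial.aeval_X, algebraMap_eq]
    ring

open MvPolynomial in
theorem rees_span_le_ker :
    Ideal.span {C (xv - tv) * X 1 - C yv * X 0, C (yv - tv) * X 1 - C xv * X 2} ≤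
      RingHom.ker reesMap := by
  rw [Ideal.span_le, Set.pair_subset_iff]
  constructor <;>
  · simp only [SetLike.mem_coe, RingHom.mem_ker, reesMap, map_sub, map_mul, aeval_X,
      algHom_C, Polynomial.algebraMap_eq, Matrix.cons_val]
    ring

/-- The kernel of the map presenting the Rees algebra of `(x(x−t), xy, y(y−t))` is
generated by `(x−t)ξ₁ − yξ₀` and `(y−t)ξ₁ − xξ₂`. -/
theorem rees_kernel :
    RingHom.ker reesMap
      = Ideal.span
          {MvPolynomial.C (xv - tv) * MvPolynomial.X 1
              - MvPolynomial.C yv * MvPolynomial.X 0,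
            MvPolynomial.C (yv - tv) * MvPolynomial.X 1
              - MvPolynomial.C xv * MvPolynomial.X 2} := by
  refine le_antisymm (fun F hF => ?_) rees_span_le_ker
  obtain ⟨N, q, hq⟩ := exists_pow_mul_sub_aeval_mem F
  have hq0 : q = 0 := by
    have h := RingHom.mem_ker.mp (rees_span_le_ker hq)
    rw [map_sub, map_mul, RingHom.mem_ker.mp hF, mul_zero, zero_sub, neg_eq_zero,
      ← Polynomial.aeval_algHom_apply] at h
    have h1 : reesMap (MvPolynomial.X 1) = Polynomial.C (xv * yv) * Polynomial.X := by
      simp [reesMap]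
    rw [h1, ← Polynomial.comp_eq_aeval, Polynomial.comp_C_mul_X_eq_zero_iff] at h
    · exact h
    · exact mem_nonZeroDivisors_of_ne_zero
        (mul_ne_zero (MvPolynomial.X_ne_zero 0) (MvPolynomial.X_ne_zero 1))
  rw [hq0, map_zero, sub_zero] at hq
  clear hq0 hF
  induction N with
  | zero => simpa using hq
  | succ N ih =>
    refine ih (rees_mem_of_C_yv_mul_mem (rees_mem_of_C_xv_mul_mem ?_))
    convert hq using 1
    rw [MvPolynomial.C_mul]
    ring
end
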